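/- For all partitions λ and μ, the following identity holds in ℚ(q1,q2,z): N_{λ,μ}(z) = ∏_{c∈λ, c'∈μ} S(z χ_c/χ_{c'}) · ∏_{c∈λ} (1 − q3^{−1} z χ_c) · ∏_{c'∈μ} (1 − z χ_{c'}^{−1}), where S(w) := (1−q1 w)(1−q2 w)/((1−w)(1−q1 q2 w)). (Equivalence of the arm–leg and the S-function expressions for the Nekrasov factor.) -/

import Mathlib

open scoped BigOperators

noncomputable section

/-- The field `ℚ(q1, q2, z)` of rational functions in three independent indeterminates. -/
abbrev K : Type := FractionRing (MvPolynomial (Fin 3) ℚ)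

/-- The indeterminate `q1`. -/
def q1 : K := algebraMap (MvPolynomial (Fin 3) ℚ) K (MvPolynomial.X 0)

/-- The indeterminate `q2`. -/
def q2 : K := algebraMap (MvPolynomial (Fin 3) ℚ) K (MvPolynomial.X 1)

/-- The indeterminate `z`. -/
def z : K := algebraMap (MvPolynomial (Fin 3) ℚ) K (MvPolynomial.X 2)

/-- `q3 = (q1 q2)⁻¹`. -/
def q3 : K := (q1 * q2)⁻¹

/-- Box content `χ_c = q1^(i-1) * q2^(j-1)` of the 1-indexed cell `(i,j)`.
Here cells of a `YoungDiagram` are 0-indexed, so the cell `c` corresponding to the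
1-indexed cell `(i,j)` is `c = (i-1, j-1)` and `χ_c = q1^c.1 * q2^c.2`. -/
def chi (c : ℕ × ℕ) : K := q1 ^ c.1 * q2 ^ c.2

/-- `c` is an addable cell of the Young diagram `d`: it is not a cell of `d` and adjoining
it again gives (the cells of) a Young diagram. -/
def IsAddable (d : YoungDiagram) (c : ℕ × ℕ) : Prop :=
  c ∉ d.cells ∧ IsLowerSet (↑(insert c d.cells) : Set (ℕ × ℕ))

/-- `c` is a removable cell of the Young diagram `d`: it is a cell of `d` and deleting
it again gives (the cells of) a Young diagram. -/
def IsRemovable (d : YoungDiagram) (c : ℕ × ℕ) : Prop :=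
  c ∈ d.cells ∧ IsLowerSet (↑(d.cells.erase c) : Set (ℕ × ℕ))

open Classical in
/-- The (finite) set `A(d)` of addable cells of `d`; every addable cell `(i,j)` satisfies
`i ≤ colLen 0` and `j ≤ rowLen 0`, so filtering the bounding box captures all of them. -/
noncomputable def addables (d : YoungDiagram) : Finset (ℕ × ℕ) :=
  (Finset.range (d.colLen 0 + 1) ×ˢ Finset.range (d.rowLen 0 + 1)).filter (IsAddable d)

open Classical in
/-- The (finite) set `R(d)` of removable cells of `d`. -/
noncomputable def removables (d : YoungDiagram) : Finset (ℕ × ℕ) :=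
  d.cells.filter (IsRemovable d)

/-- The (K-theoretic) Nekrasov factor
`N_{λ,μ}(w) = ∏_{(i,j)∈λ} (1 − w q1^{λ^T_j − i + 1} q2^{j − μ_i})`
`           · ∏_{(i,j)∈μ} (1 − w q1^{i − μ^T_j} q2^{λ_i − j + 1})`
written in terms of 0-indexed cells (`λ^T_j = colLen (j-1)`, `λ_i = rowLen (i-1)`). -/
def nek (lam mu : YoungDiagram) (w : K) : K :=
  (∏ c ∈ lam.cells,
      (1 - w * q1 ^ ((lam.colLen c.2 : ℤ) - (c.1 : ℤ)) *
        q2 ^ ((c.2 : ℤ) + 1 - (mu.rowLen c.1 : ℤ)))) *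
    ∏ c ∈ mu.cells,
      (1 - w * q1 ^ ((c.1 : ℤ) + 1 - (mu.colLen c.2 : ℤ)) *
        q2 ^ ((lam.rowLen c.1 : ℤ) - (c.2 : ℤ)))

/-- `S(w) = (1−q1 w)(1−q2 w)/((1−w)(1−q1 q2 w))`. -/
def Sfun (w : K) : K := ((1 - q1 * w) * (1 - q2 * w)) / ((1 - w) * (1 - q1 * q2 * w))


section generic
open Finset

variable {k : Type*} [Field k]

lemma div_eq_iff_aux {a b c : k} (h : b ≠ 0) : a / b = c ↔ a = b * c := by
  rw [div_eq_iff h, mul_comm]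

lemma aux_path (F : ℕ → ℕ → k) (hF : ∀ i j, F i j ≠ 0) (d : YoungDiagram) (n : ℕ) :
    ∀ r, d.colLen 0 ≤ r + n →
    F r (d.rowLen r) * ∏ j ∈ range (d.rowLen r), (F (d.colLen j) j / F (d.colLen j) (j+1))
      = F (r + n) 0 * ∏ i ∈ Ico r (r + n), (F i (d.rowLen i) / F (i+1) (d.rowLen i)) := by
  induction n with
  | zero =>
    intro r hr
    have h0 : d.rowLen r = 0 := by
      by_contra h
      have : (r, 0) ∈ d := YoungDiagram.mem_iff_lt_rowLen.2 (by omega)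
      have := YoungDiagram.mem_iff_lt_colLen.1 this
      omega
    simp [h0]
  | succ n ih =>
    intro r hr
    have h := ih (r+1) (by omega)
    have hle : d.rowLen (r+1) ≤ d.rowLen r := d.rowLen_anti _ _ (by omega)
    have ht : ∀ m, d.rowLen (r+1) ≤ m → m ≤ d.rowLen r →
        ∏ j ∈ range m, (F (d.colLen j) j / F (d.colLen j) (j+1)) =
        (∏ j ∈ range (d.rowLen (r+1)), (F (d.colLen j) j / F (d.colLen j) (j+1))) *
          (F (r+1) (d.rowLen (r+1)) / F (r+1) m) := by
      intro m hm
      induction m, hm using Nat.le_induction with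
      | base => intro _; rw [div_self (hF _ _), mul_one]
      | succ m hm ihm =>
        intro hm2
        have hc : d.colLen m = r + 1 := by
          have h1 : (r, m) ∈ d := YoungDiagram.mem_iff_lt_rowLen.2 (by omega)
          have h1 := YoungDiagram.mem_iff_lt_colLen.1 h1
          have h2 : ¬ (r+1, m) ∈ d := fun h => by
            have := YoungDiagram.mem_iff_lt_rowLen.1 h
            omega
          rw [YoungDiagram.mem_iff_lt_colLen] at h2
          omega
        rw [prod_range_succ, ihm (by omega), hc]
        have := hF (r+1) m
        have := hF (r+1) (m+1)
        field_simp
    rw [ht _ hle le_rfl, prod_eq_prod_Ico_succ_bot (by omega)]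
    rw [show r + (n+1) = r + 1 + n by omega]
    have := hF (r+1) (d.rowLen r)
    calc _ = (F (r+1) (d.rowLen (r+1)) * ∏ j ∈ range (d.rowLen (r+1)), (F (d.colLen j) j / F (d.colLen j) (j+1))) * (F r (d.rowLen r) / F (r+1) (d.rowLen r)) := by
            field_simp
      _ = _ := by rw [h]; ring

lemma aux_cells (d : YoungDiagram) (L : ℕ) (hL : d.colLen 0 ≤ L) (g : ℕ × ℕ → k) :
    ∏ c ∈ d.cells, g c = ∏ i ∈ range L, ∏ j ∈ range (d.rowLen i), g (i, j) := by
  rw [prod_sigma']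
  refine prod_nbij' (fun c => ⟨c.1, c.2⟩) (fun c => (c.1, c.2)) ?_ ?_ ?_ ?_ ?_
  · rintro ⟨i, j⟩ h
    rw [YoungDiagram.mem_cells] at h
    have h0 : (i, 0) ∈ d := d.up_left_mem le_rfl (Nat.zero_le _) h
    have h0 := YoungDiagram.mem_iff_lt_colLen.1 h0
    have h1 := YoungDiagram.mem_iff_lt_rowLen.1 h
    simp only [mem_sigma, mem_range]
    omega
  · rintro ⟨i, j⟩ h
    simp only [mem_sigma, mem_range] at h
    exact (YoungDiagram.mem_cells _).2 (YoungDiagram.mem_iff_lt_rowLen.2 h.2)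
  all_goals simp

lemma aux_key (F : ℕ → ℕ → k) (hF : ∀ i j, F i j ≠ 0) (d : YoungDiagram) (r : ℕ) :
    F 0 0 * ∏ c ∈ d.cells, (F (c.1+1) c.2 * F c.1 (c.2+1) / (F c.1 c.2 * F (c.1+1) (c.2+1)))
      = F r (d.rowLen r) * (∏ j ∈ range (d.rowLen r), (F (d.colLen j) j / F (d.colLen j) (j+1))) *
        ∏ i ∈ range r, (F i (d.rowLen i) / F (i+1) (d.rowLen i)) := by
  rw [aux_path F hF d (d.colLen 0) r (by omega), aux_cells d (r + d.colLen 0) (by omega), mul_assoc,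
    mul_comm (∏ i ∈ Ico _ _, _), prod_range_mul_prod_Ico _ (by omega)]
  have h1 : ∀ i m, ∏ j ∈ range m, (F (i+1) j * F i (j+1) / (F i j * F (i+1) (j+1)))
      = F (i+1) 0 / F i 0 * (F i m / F (i+1) m) := by
    intro i m
    have := hF i 0
    have := hF (i+1) 0
    induction m with
    | zero => simp; field_simp
    | succ m ih =>
      have := hF i m
      have := hF (i+1) m
      have := hF i (m+1)
      have := hF (i+1) (m+1)
      rw [prod_range_succ, ih]; field_simp
  have h2 : ∀ m, F 0 0 * ∏ i ∈ range m, (F (i+1) 0 / F i 0) = F m 0 := by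
    intro m
    induction m with
    | zero => simp
    | succ m ih =>
      have := hF m 0
      rw [prod_range_succ, ← mul_assoc, ih]; field_simp
  simp only [h1, prod_mul_distrib]
  rw [← mul_assoc, h2]

lemma aux_row (d : YoungDiagram) (r : ℕ) (g : ℕ × ℕ → k) (hg : ∀ c, c.1 ≠ r → g c = 1) :
    ∏ c ∈ d.cells, g c = ∏ j ∈ range (d.rowLen r), g (r, j) := by
  have : ∏ c ∈ d.row r, g c = ∏ c ∈ d.cells, g c := by
    refine prod_subset (filter_subset _ _) ?_
    intro c hc hn
    apply hg
    intro h
    exact hn (YoungDiagram.mem_row_iff.2 ⟨hc, h⟩)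
  rw [← this, YoungDiagram.row_eq_prod, prod_product]
  simp

lemma aux_col (d : YoungDiagram) (r : ℕ) (g : ℕ × ℕ → k) (hg : ∀ c, c.2 ≠ r → g c = 1) :
    ∏ c ∈ d.cells, g c = ∏ j ∈ range (d.colLen r), g (j, r) := by
  have : ∏ c ∈ d.col r, g c = ∏ c ∈ d.cells, g c := by
    refine prod_subset (filter_subset _ _) ?_
    intro c hc hn
    apply hg
    intro h
    exact hn (YoungDiagram.mem_col_iff.2 ⟨hc, h⟩)
  rw [← this, YoungDiagram.col_eq_prod, prod_product]
  simp

lemma aux_corner (d : YoungDiagram) (hd : d.cells.Nonempty) :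
    ∃ (e : YoungDiagram) (a b : ℕ), (a, b) ∉ e.cells ∧ d.cells = insert (a, b) e.cells ∧
      e.rowLen a = b ∧ d.rowLen a = b + 1 ∧ e.colLen b = a ∧ d.colLen b = a + 1 ∧
      (∀ i, i ≠ a → d.rowLen i = e.rowLen i) ∧ (∀ j, j ≠ b → d.colLen j = e.colLen j) := by
  obtain ⟨⟨i0, j0⟩, h0⟩ := hd
  rw [YoungDiagram.mem_cells] at h0
  have h00 : (i0, 0) ∈ d := d.up_left_mem le_rfl (Nat.zero_le _) h0
  have hp := YoungDiagram.mem_iff_lt_colLen.1 h00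
  obtain ⟨a, ha⟩ : ∃ a, d.colLen 0 = a + 1 := ⟨d.colLen 0 - 1, by omega⟩
  have ha0 : (a, 0) ∈ d := YoungDiagram.mem_iff_lt_colLen.2 (by omega)
  have hq := YoungDiagram.mem_iff_lt_rowLen.1 ha0
  obtain ⟨b, hb⟩ : ∃ b, d.rowLen a = b + 1 := ⟨d.rowLen a - 1, by omega⟩
  have hab : (a, b) ∈ d := YoungDiagram.mem_iff_lt_rowLen.2 (by omega)
  have hcol : d.colLen b = a + 1 := by
    have h1 := YoungDiagram.mem_iff_lt_colLen.1 hab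
    have h2 := d.colLen_anti 0 b (by omega)
    omega
  let e : YoungDiagram := ⟨d.cells.erase (a, b), by
    rintro ⟨i, j⟩ ⟨i', j'⟩ hle hx
    obtain ⟨h1, h2⟩ : i' ≤ i ∧ j' ≤ j := hle
    simp only [coe_erase, Set.mem_diff, mem_coe, YoungDiagram.mem_cells,
      Set.mem_singleton_iff, Prod.mk.injEq] at hx ⊢
    refine ⟨d.up_left_mem h1 h2 hx.1, ?_⟩
    rintro ⟨rfl, rfl⟩
    have h3 := YoungDiagram.mem_iff_lt_colLen.1 hx.1
    have h4 := YoungDiagram.mem_iff_lt_rowLen.1 hx.1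
    have h5 := d.colLen_anti _ _ h2
    have h6 := d.rowLen_anti _ _ h1
    exact hx.2 ⟨by omega, by omega⟩⟩
  have he : ∀ i j, (i, j) ∈ e ↔ ((i, j) ∈ d ∧ ¬ (i = a ∧ j = b)) := by
    intro i j
    rw [← YoungDiagram.mem_cells]
    simp only [e, mem_erase, YoungDiagram.mem_cells, ne_eq, Prod.mk.injEq]
    tauto
  have hr : ∀ i j, j < e.rowLen i ↔ (j < d.rowLen i ∧ ¬ (i = a ∧ j = b)) := by
    intro i j
    rw [← YoungDiagram.mem_iff_lt_rowLen, ← YoungDiagram.mem_iff_lt_rowLen, he]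
  have hc : ∀ i j, i < e.colLen j ↔ (i < d.colLen j ∧ ¬ (i = a ∧ j = b)) := by
    intro i j
    rw [← YoungDiagram.mem_iff_lt_colLen, ← YoungDiagram.mem_iff_lt_colLen, he]
  refine ⟨e, a, b, by simp [e], ?_, ?_, hb, ?_, hcol, ?_, ?_⟩
  · simp only [e]
    rw [insert_erase]
    exact (YoungDiagram.mem_cells _).2 hab
  · apply eq_of_forall_lt_iff
    intro j; rw [hr]; omega
  · apply eq_of_forall_lt_iff
    intro j; rw [hc]; omega
  · intro i hi
    apply eq_of_forall_lt_iff
    intro j; rw [hr]; omega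
  · intro i hi
    apply eq_of_forall_lt_iff
    intro j; rw [hc]; omega

/-- generic version -/
lemma aux_main (f : ℤ → ℤ → k) (hf : ∀ a b, f a b ≠ 0) (lam : YoungDiagram) (n : ℕ) :
    ∀ mu : YoungDiagram, mu.cells.card = n →
    (∏ c ∈ lam.cells, f ((lam.colLen c.2 : ℤ) - c.1) ((c.2 : ℤ) + 1 - mu.rowLen c.1)) *
      ∏ c ∈ mu.cells, f ((c.1 : ℤ) + 1 - mu.colLen c.2) ((lam.rowLen c.1 : ℤ) - c.2)
    = (∏ c' ∈ mu.cells, (f (0 - c'.1) (0 - c'.2) * ∏ c ∈ lam.cells,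
        (f ((c.1 : ℤ) + 1 - c'.1) ((c.2 : ℤ) - c'.2) * f ((c.1 : ℤ) - c'.1) ((c.2 : ℤ) + 1 - c'.2) /
        (f ((c.1 : ℤ) - c'.1) ((c.2 : ℤ) - c'.2) * f ((c.1 : ℤ) + 1 - c'.1) ((c.2 : ℤ) + 1 - c'.2))))) *
      ∏ c ∈ lam.cells, f ((c.1 : ℤ) + 1) ((c.2 : ℤ) + 1) := by
  induction n with
  | zero =>
    intro mu hmu
    rw [card_eq_zero] at hmu
    have hr : ∀ i, mu.rowLen i = 0 := by
      intro i
      by_contra h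
      have : (i, 0) ∈ mu := YoungDiagram.mem_iff_lt_rowLen.2 (by omega)
      rw [← YoungDiagram.mem_cells, hmu] at this
      simp at this
    simp only [hmu, prod_empty, mul_one, one_mul, hr]
    have hm : ∀ c ∈ lam.cells, c.1 < lam.colLen c.2 := fun c hc =>
      YoungDiagram.mem_iff_lt_colLen.1 ((YoungDiagram.mem_cells _).1 hc)
    refine prod_nbij' (fun c => (lam.colLen c.2 - 1 - c.1, c.2))
      (fun c => (lam.colLen c.2 - 1 - c.1, c.2)) ?_ ?_ ?_ ?_ ?_
    · intro c hc
      have := hm c hc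
      exact (YoungDiagram.mem_cells _).2 (YoungDiagram.mem_iff_lt_colLen.2 (by omega))
    · intro c hc
      have := hm c hc
      exact (YoungDiagram.mem_cells _).2 (YoungDiagram.mem_iff_lt_colLen.2 (by omega))
    · intro c hc
      have := hm c hc
      ext <;> simp only [] ; omega
    · intro c hc
      have := hm c hc
      ext <;> simp only [] ; omega
    · intro c hc
      have := hm c hc
      congr 1 <;> simp only [] <;> omega
  | succ n ih =>
    intro mu hmu
    obtain ⟨e, a, b, hab, hins, hea, hda, heb, hdb, hrow, hcol⟩ :=
      aux_corner mu (card_pos.1 (by omega))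
    have hcard : e.cells.card = n := by
      rw [hins, card_insert_of_notMem hab] at hmu; omega
    have h := ih e hcard
    have key := aux_key (fun i j => f ((i : ℤ) - a) ((j : ℤ) - b)) (fun _ _ => hf _ _) lam a
    have r1 : (∏ c ∈ lam.cells, f ((lam.colLen c.2 : ℤ) - c.1) ((c.2 : ℤ) + 1 - mu.rowLen c.1)) =
        (∏ c ∈ lam.cells, f ((lam.colLen c.2 : ℤ) - c.1) ((c.2 : ℤ) + 1 - e.rowLen c.1)) *
        ∏ j ∈ range (lam.rowLen a), (f ((lam.colLen j : ℤ) - a) ((j : ℤ) - b) /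
          f ((lam.colLen j : ℤ) - a) (((j + 1 : ℕ) : ℤ) - b)) := by
      rw [← div_eq_iff_aux (prod_ne_zero_iff.2 fun _ _ => hf _ _), ← prod_div_distrib,
        aux_row lam a]
      · refine prod_congr rfl fun j _ => ?_
        simp only [hda, hea]
        congr 2 <;> push_cast <;> ring
      · intro c hc
        rw [hrow _ hc, div_self (hf _ _)]
    have r2 : (∏ c ∈ mu.cells, f ((c.1 : ℤ) + 1 - mu.colLen c.2) ((lam.rowLen c.1 : ℤ) - c.2)) =
        (∏ c ∈ e.cells, f ((c.1 : ℤ) + 1 - e.colLen c.2) ((lam.rowLen c.1 : ℤ) - c.2)) *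
        (f ((a : ℤ) - a) ((lam.rowLen a : ℤ) - b) *
        ∏ i ∈ range a, (f ((i : ℤ) - a) ((lam.rowLen i : ℤ) - b) /
          f (((i + 1 : ℕ) : ℤ) - a) ((lam.rowLen i : ℤ) - b))) := by
      rw [hins, prod_insert hab, mul_left_comm]
      congr 1
      · simp only [hdb]; congr 1; push_cast; ring
      rw [← div_eq_iff_aux (prod_ne_zero_iff.2 fun _ _ => hf _ _), ← prod_div_distrib,
        aux_col e b, heb]
      · refine prod_congr rfl fun j _ => ?_
        simp only [hdb, heb]
        congr 2 <;> push_cast <;> ring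
      · intro c hc
        rw [hcol _ hc, div_self (hf _ _)]
    rw [r1, r2, hins, prod_insert hab]
    push_cast at key ⊢
    rw [key, mul_assoc _ _ (∏ c ∈ lam.cells, f ((c.1 : ℤ) + 1) ((c.2 : ℤ) + 1)), ← h]
    ring

end generic

lemma q1_ne : q1 ≠ 0 := by
  unfold q1
  rw [Ne, FaithfulSMul.algebraMap_eq_zero_iff]
  exact MvPolynomial.X_ne_zero _

lemma q2_ne : q2 ≠ 0 := by
  unfold q2
  rw [Ne, FaithfulSMul.algebraMap_eq_zero_iff]
  exact MvPolynomial.X_ne_zero _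

def ff (a b : ℤ) : K := 1 - z * q1 ^ a * q2 ^ b

lemma ff_ne (a b : ℤ) : ff a b ≠ 0 := by
  intro h
  have h1 := q1_ne
  have h2 := q2_ne
  have h3 : q1 ^ (-a).toNat * q2 ^ (-b).toNat = z * q1 ^ a.toNat * q2 ^ b.toNat := by
    have ea : q1 ^ a.toNat = q1 ^ a * q1 ^ (-a).toNat := by
      rw [← zpow_natCast, ← zpow_natCast, ← zpow_add₀ h1]; congr 1; omega
    have eb : q2 ^ b.toNat = q2 ^ b * q2 ^ (-b).toNat := by
      rw [← zpow_natCast, ← zpow_natCast, ← zpow_add₀ h2]; congr 1; omega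
    rw [ea, eb]
    unfold ff at h
    linear_combination (q1 ^ (-a).toNat * q2 ^ (-b).toNat) * h
  unfold q1 q2 z at h3
  simp only [← map_pow, ← map_mul] at h3
  have h4 := FaithfulSMul.algebraMap_injective _ _ h3
  have h5 := congrArg (MvPolynomial.eval (![1, 1, 0] : Fin 3 → ℚ)) h4
  simp at h5

/-- For all partitions `λ, μ`, in `ℚ(q1,q2,z)`:
`N_{λ,μ}(z) = ∏_{c∈λ, c'∈μ} S(z χ_c/χ_{c'}) · ∏_{c∈λ} (1 − q3⁻¹ z χ_c) · ∏_{c'∈μ} (1 − z χ_{c'}⁻¹)`. -/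
theorem stmt3 (lam mu : YoungDiagram) :
    nek lam mu z
      = (∏ c ∈ lam.cells, ∏ c' ∈ mu.cells, Sfun (z * chi c / chi c')) *
          (∏ c ∈ lam.cells, (1 - q3⁻¹ * z * chi c)) *
          ∏ c' ∈ mu.cells, (1 - z * (chi c')⁻¹) := by
  have h1 := q1_ne
  have h2 := q2_ne
  have key := aux_main ff ff_ne lam _ mu rfl
  have e1 : nek lam mu z = (∏ c ∈ lam.cells, ff ((lam.colLen c.2 : ℤ) - c.1) ((c.2 : ℤ) + 1 - mu.rowLen c.1)) *
      ∏ c ∈ mu.cells, ff ((c.1 : ℤ) + 1 - mu.colLen c.2) ((lam.rowLen c.1 : ℤ) - c.2) := rfl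
  rw [e1, key, Finset.prod_mul_distrib, Finset.prod_comm]
  have e2 : ∀ c : ℕ × ℕ, 1 - q3⁻¹ * z * chi c = ff ((c.1 : ℤ) + 1) ((c.2 : ℤ) + 1) := by
    intro c
    unfold q3 chi ff
    rw [zpow_add₀ h1, zpow_add₀ h2, zpow_natCast, zpow_natCast, zpow_one, zpow_one, inv_inv]
    ring
  have e3 : ∀ c : ℕ × ℕ, 1 - z * (chi c)⁻¹ = ff (0 - c.1) (0 - c.2) := by
    intro c
    unfold chi ff
    rw [zpow_sub₀ h1, zpow_sub₀ h2, zpow_natCast, zpow_natCast, zpow_zero, zpow_zero]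
    field_simp
  have e4 : ∀ c c' : ℕ × ℕ, Sfun (z * chi c / chi c') =
      (ff ((c.1 : ℤ) + 1 - c'.1) ((c.2 : ℤ) - c'.2) * ff ((c.1 : ℤ) - c'.1) ((c.2 : ℤ) + 1 - c'.2) /
        (ff ((c.1 : ℤ) - c'.1) ((c.2 : ℤ) - c'.2) *
          ff ((c.1 : ℤ) + 1 - c'.1) ((c.2 : ℤ) + 1 - c'.2))) := by
    intro c c'
    have hw : z * chi c / chi c' = z * q1 ^ ((c.1 : ℤ) - c'.1) * q2 ^ ((c.2 : ℤ) - c'.2) := by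
      unfold chi
      rw [zpow_sub₀ h1, zpow_sub₀ h2]
      simp only [zpow_natCast]
      field_simp
    rw [hw, Sfun, ff, ff, ff, ff, add_sub_right_comm, add_sub_right_comm,
      zpow_add_one₀ h1, zpow_add_one₀ h2]
    congr 1 <;> ring
  simp only [e2, e3, e4]
  ring

end
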